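/- A sequence q_1 q_2 ⋯ q_n from {A, S, N} is attainable over a field of characteristic 0 if and only if both of the following hold: (i) q_n ≠ S, and (ii) neither NA nor NS occurs as a consecutive subsequence of q_1 q_2 ⋯ q_n (equivalently, every term following an N is N). -/

import Mathlib

open Matrix

/-- The minor of a square matrix `B` lying in the rows indexed by `α` and the columns
indexed by `β` (each listed in increasing order); junk value `0` if `α.card ≠ β.card`. -/
def qMinor {R : Type*} [CommRing R] {m : Type*} [Fintype m] [LinearOrder m]
    (B : Matrix m m R) (α β : Finset m) : R :=
  if h : β.card = α.card then
    (Matrix.of fun i j : Fin α.card =>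
      B (α.orderEmbOfFin rfl i) (β.orderEmbOfFin h j)).det
  else 0

/-- `α` and `β` index a quasi-principal submatrix of order `k`, i.e.
`|α| = |β| = k` and `k - 1 ≤ |α ∩ β| (≤ k)`. -/
def IsQPPair {m : Type*} [DecidableEq m] (k : ℕ) (α β : Finset m) : Prop :=
  α.card = k ∧ β.card = k ∧ k - 1 ≤ (α ∩ β).card

/-- All quasi-principal minors of `B` of order `k` are nonzero. -/
def QPAllNonzero {R : Type*} [CommRing R] {m : Type*} [Fintype m] [LinearOrder m]
    (B : Matrix m m R) (k : ℕ) : Prop :=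
  ∀ α β : Finset m, IsQPPair k α β → qMinor B α β ≠ 0

/-- All quasi-principal minors of `B` of order `k` are zero. -/
def QPAllZero {R : Type*} [CommRing R] {m : Type*} [Fintype m] [LinearOrder m]
    (B : Matrix m m R) (k : ℕ) : Prop :=
  ∀ α β : Finset m, IsQPPair k α β → qMinor B α β = 0

/-- The three possible letters of a qpr-sequence. -/
inductive QPR : Type
  | A
  | S
  | N
deriving DecidableEq

open Classical in
/-- The letter of the qpr-sequence of `B` corresponding to order `k`:
`A` if all quasi-principal minors of order `k` are nonzero, `N` if all are zero,
and `S` otherwise. -/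
noncomputable def qprEntry {R : Type*} [CommRing R] {m : Type*} [Fintype m] [LinearOrder m]
    (B : Matrix m m R) (k : ℕ) : QPR :=
  if QPAllNonzero B k then QPR.A
  else if QPAllZero B k then QPR.N
  else QPR.S

/-- A sequence of letters `q 0, …, q (n-1)` (standing for `q_1 ⋯ q_n`) is attainable
over `F` if it is the qpr-sequence of an `n × n` symmetric matrix over `F`. -/
def Attainable (F : Type*) [Field F] {n : ℕ} (q : Fin n → QPR) : Prop :=
  ∃ B : Matrix (Fin n) (Fin n) F, B.IsSymm ∧ ∀ k : Fin n, qprEntry B ((k : ℕ) + 1) = q k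

/-- The Schur complement `B/B[γ] = B[γᶜ] - B[γᶜ, γ] B[γ]⁻¹ B[γ, γᶜ]`,
with rows and columns indexed by `γᶜ` (indexing inherited from `B`). -/
noncomputable def schurCompl {R : Type*} [CommRing R] {n : ℕ}
    (B : Matrix (Fin n) (Fin n) R) (γ : Finset (Fin n)) :
    Matrix ↥(γᶜ) ↥(γᶜ) R :=
  B.submatrix (fun i : ↥(γᶜ) => (i : Fin n)) (fun j : ↥(γᶜ) => (j : Fin n)) -
    B.submatrix (fun i : ↥(γᶜ) => (i : Fin n)) (fun j : ↥γ => (j : Fin n)) *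
      (B.submatrix (fun i : ↥γ => (i : Fin n)) fun j : ↥γ => (j : Fin n))⁻¹ *
      B.submatrix (fun i : ↥γ => (i : Fin n)) fun j : ↥(γᶜ) => (j : Fin n)

/-- The `(m+1) × (m+1)` matrix with block form `[[A, x], [yᵀ, b]]`. -/
def borderMat {R : Type*} [CommRing R] {m : ℕ} (A : Matrix (Fin m) (Fin m) R)
    (x y : Fin m → R) (b : R) : Matrix (Fin (m + 1)) (Fin (m + 1)) R :=
  Matrix.of fun i j =>
    if hi : (i : ℕ) < m then
      if hj : (j : ℕ) < m then A ⟨i, hi⟩ ⟨j, hj⟩ else x ⟨i, hi⟩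
    else
      if hj : (j : ℕ) < m then y ⟨j, hj⟩ else b

theorem qMinor_eq_det {R : Type*} [CommRing R] {m : Type*} [Fintype m] [LinearOrder m]
    (B : Matrix m m R) (α β : Finset m) (k : ℕ) (hα : α.card = k) (hβ : β.card = k) :
    qMinor B α β = (B.submatrix (α.orderEmbOfFin hα) (β.orderEmbOfFin hβ)).det := by
  subst hα
  unfold qMinor
  rw [dif_pos hβ]
  rfl

theorem orderEmb_succAbove {m : Type*} [LinearOrder m] (α : Finset m) (k : ℕ)
    (hα : α.card = k + 1) (p : Fin (k + 1))
    (h : (α.erase (α.orderEmbOfFin hα p)).card = k) :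
    (fun i => α.orderEmbOfFin hα (p.succAbove i)) =
      (α.erase (α.orderEmbOfFin hα p)).orderEmbOfFin h := by
  apply Finset.orderEmbOfFin_unique
  · intro x
    rw [Finset.mem_erase]
    refine ⟨?_, Finset.orderEmbOfFin_mem _ _ _⟩
    intro e
    exact Fin.succAbove_ne p x ((α.orderEmbOfFin hα).injective e)
  · exact (α.orderEmbOfFin hα).strictMono.comp (Fin.strictMono_succAbove p)

theorem allZero_succ {R : Type*} [CommRing R] {m : Type*} [Fintype m] [LinearOrder m]
    (B : Matrix m m R) (k : ℕ) (h : QPAllZero B (k + 1)) : QPAllZero B (k + 2) := by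
  rintro α β ⟨hα, hβ, hi⟩
  have hex : ∃ i ∈ α, α.erase i ⊆ β := by
    by_cases hs : α ⊆ β
    · have : α.Nonempty := by rw [← Finset.card_pos]; omega
      obtain ⟨i, hi⟩ := this
      exact ⟨i, hi, (Finset.erase_subset _ _).trans hs⟩
    · obtain ⟨i, hia, hib⟩ := Finset.not_subset.1 hs
      refine ⟨i, hia, ?_⟩
      have hsub : α ∩ β ⊆ α.erase i := by
        intro x hx
        rw [Finset.mem_inter] at hx
        rw [Finset.mem_erase]
        refine ⟨?_, hx.1⟩
        rintro rfl
        exact hib hx.2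
      have := Finset.eq_of_subset_of_card_le hsub (by rw [Finset.card_erase_of_mem hia]; omega)
      rw [← this]
      exact Finset.inter_subset_right
  obtain ⟨i, hia, hsub⟩ := hex
  obtain ⟨p, rfl⟩ : ∃ p, α.orderEmbOfFin hα p = i := by
    have : i ∈ Set.range (α.orderEmbOfFin hα) := by simpa using hia
    exact this
  rw [qMinor_eq_det B α β _ hα hβ, Matrix.det_succ_row _ p]
  apply Finset.sum_eq_zero
  intro j _
  have ca : (α.erase (α.orderEmbOfFin hα p)).card = k + 1 := by
    rw [Finset.card_erase_of_mem hia]; omega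
  have cb : (β.erase (β.orderEmbOfFin hβ j)).card = k + 1 := by
    rw [Finset.card_erase_of_mem (Finset.orderEmbOfFin_mem _ _ _)]; omega
  have key := h (α.erase (α.orderEmbOfFin hα p)) (β.erase (β.orderEmbOfFin hβ j))
    ⟨ca, cb, by
      have : (α.erase (α.orderEmbOfFin hα p)).erase (β.orderEmbOfFin hβ j) ⊆
          (α.erase (α.orderEmbOfFin hα p)) ∩ (β.erase (β.orderEmbOfFin hβ j)) := by
        intro x hx
        rw [Finset.mem_erase] at hx
        rw [Finset.mem_inter, Finset.mem_erase (s := β)]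
        exact ⟨hx.2, hx.1, hsub hx.2⟩
      have h1 := Finset.card_le_card this
      have h2 := Finset.pred_card_le_card_erase (s := α.erase (α.orderEmbOfFin hα p))
        (a := β.orderEmbOfFin hβ j)
      omega⟩
  rw [qMinor_eq_det _ _ _ _ ca cb, ← orderEmb_succAbove, ← orderEmb_succAbove] at key
  rw [Matrix.submatrix_submatrix]
  have : (B.submatrix (⇑(α.orderEmbOfFin hα) ∘ p.succAbove)
      (⇑(β.orderEmbOfFin hβ) ∘ j.succAbove)).det = 0 := key
  rw [this, mul_zero]

/-- The pattern of entries of the factor `L` allowed to be nonzero. -/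
def Allowed {n : ℕ} (q : Fin n → QPR) (i j : Fin n) : Prop :=
  j ≤ i ∧ q j ≠ QPR.N ∧ ¬ ((i : ℕ) + 1 = n ∧ q j = QPR.S)

open Classical in
/-- The lower triangular factor. -/
noncomputable def Lm {n : ℕ} (q : Fin n → QPR) {R : Type*} [CommRing R]
    (x : Fin n × Fin n → R) : Matrix (Fin n) (Fin n) R :=
  Matrix.of fun i j => if Allowed q i j then x (i, j) else 0

theorem Lm_not {n : ℕ} (q : Fin n → QPR) {R : Type*} [CommRing R]
    (x : Fin n × Fin n → R) {i j : Fin n} (h : ¬ Allowed q i j) : Lm q x i j = 0 := by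
  simp [Lm, h]

theorem Lm_yes {n : ℕ} (q : Fin n → QPR) {R : Type*} [CommRing R]
    (x : Fin n × Fin n → R) {i j : Fin n} (h : Allowed q i j) : Lm q x i j = x (i, j) := by
  simp [Lm, h]

theorem Lm_map {n : ℕ} (q : Fin n → QPR) {R : Type*} [CommRing R]
    (x : Fin n × Fin n → R) :
    (Lm q (MvPolynomial.X : Fin n × Fin n → MvPolynomial (Fin n × Fin n) R)).map
      (MvPolynomial.eval x) = Lm q x := by
  ext i j
  by_cases h : Allowed q i j <;> simp [Lm, h]

theorem mul_trunc {R ι κ : Type*} [CommRing R] {n m : ℕ} (hm : m ≤ n)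
    (A : Matrix ι (Fin n) R) (B : Matrix κ (Fin n) R)
    (hA : ∀ i (j : Fin n), m ≤ (j : ℕ) → A i j = 0) :
    A * Bᵀ = A.submatrix id (Fin.castLE hm) * (B.submatrix id (Fin.castLE hm))ᵀ := by
  ext i j
  simp only [Matrix.mul_apply, Matrix.transpose_apply, Matrix.submatrix_apply, id]
  symm
  apply Fintype.sum_of_injective (Fin.castLE hm) (Fin.castLE_injective hm)
  · intro l hl
    rw [hA, zero_mul]
    by_contra hlt
    exact hl ⟨⟨l, by omega⟩, rfl⟩
  · intro l
    rfl

theorem common_nonroot {F σ ι : Type*} [Field F] [Infinite F] [Finite ι]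
    (p : ι → MvPolynomial σ F) (h : ∀ i, ∃ x, MvPolynomial.eval x (p i) ≠ 0) :
    ∃ x, ∀ i, MvPolynomial.eval x (p i) ≠ 0 := by
  classical
  have := Fintype.ofFinite ι
  by_contra! hc
  have h0 : ∏ i, p i = 0 := by
    apply MvPolynomial.funext
    intro x
    obtain ⟨i, hi⟩ := hc x
    rw [map_prod, map_zero]
    exact Finset.prod_eq_zero (Finset.mem_univ i) hi
  rw [Finset.prod_eq_zero_iff] at h0
  obtain ⟨i, _, hi⟩ := h0
  obtain ⟨x, hx⟩ := h i
  rw [hi] at hx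
  simp at hx

/-- `α` is a row set of size `k+1` whose diagonal with the first `k+1` columns is allowed. -/
def Good {n : ℕ} (q : Fin n → QPR) (k : Fin n) (α : Finset (Fin n)) : Prop :=
  ∃ h : α.card = (k : ℕ) + 1, ∀ i : Fin ((k : ℕ) + 1),
    Allowed q (α.orderEmbOfFin h i) (Fin.castLE (Nat.succ_le_of_lt k.2) i)

/-- The rows `α`, first `k+1` columns submatrix. -/
noncomputable def Lsub {n : ℕ} (q : Fin n → QPR) {R : Type*} [CommRing R]
    (x : Fin n × Fin n → R) (k : Fin n) (α : Finset (Fin n)) (h : α.card = (k : ℕ) + 1) :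
    Matrix (Fin ((k : ℕ) + 1)) (Fin ((k : ℕ) + 1)) R :=
  (Lm q x).submatrix (α.orderEmbOfFin h) (Fin.castLE (Nat.succ_le_of_lt k.2))

theorem Lsub_map {n : ℕ} (q : Fin n → QPR) {R : Type*} [CommRing R]
    (x : Fin n × Fin n → R) (k : Fin n) (α : Finset (Fin n)) (h : α.card = (k : ℕ) + 1) :
    MvPolynomial.eval x (Lsub q (MvPolynomial.X : Fin n × Fin n → MvPolynomial _ R) k α h).det =
      (Lsub q x k α h).det := by
  rw [RingHom.map_det]
  unfold Lsub
  rw [← Lm_map q x]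
  rfl

theorem Lsub_spec {n : ℕ} (q : Fin n → QPR) {R : Type*} [CommRing R] [Nontrivial R]
    (k : Fin n) (α : Finset (Fin n)) (h : α.card = (k : ℕ) + 1)
    (hg : ∀ i : Fin ((k : ℕ) + 1),
      Allowed q (α.orderEmbOfFin h i) (Fin.castLE (Nat.succ_le_of_lt k.2) i)) :
    ∃ x : Fin n × Fin n → R, (Lsub q x k α h).det ≠ 0 := by
  classical
  refine ⟨fun p => if ∃ i, α.orderEmbOfFin h i = p.1 ∧
    Fin.castLE (Nat.succ_le_of_lt k.2) i = p.2 then 1 else 0, ?_⟩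
  have : Lsub q (fun p : Fin n × Fin n => if ∃ i, α.orderEmbOfFin h i = p.1 ∧
    Fin.castLE (Nat.succ_le_of_lt k.2) i = p.2 then (1 : R) else 0) k α h = 1 := by
    ext i j
    unfold Lsub
    rw [Matrix.submatrix_apply]
    by_cases hij : i = j
    · subst hij
      rw [Lm_yes q _ (hg i), if_pos ⟨i, rfl, rfl⟩, Matrix.one_apply_eq]
    · rw [Matrix.one_apply_ne hij]
      by_cases ha : Allowed q (α.orderEmbOfFin h i) (Fin.castLE (Nat.succ_le_of_lt k.2) j)
      · rw [Lm_yes q _ ha, if_neg]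
        rintro ⟨l, h1, h2⟩
        have e1 := (α.orderEmbOfFin h).injective h1
        have e2 := Fin.castLE_injective _ h2
        exact hij (e1.symm.trans e2)
      · rw [Lm_not q _ ha]
  rw [this, Matrix.det_one]
  exact one_ne_zero

theorem qMinor_LL {n : ℕ} (q : Fin n → QPR) {R : Type*} [CommRing R]
    (x : Fin n × Fin n → R) (k : Fin n) (α β : Finset (Fin n))
    (hα : α.card = (k : ℕ) + 1) (hβ : β.card = (k : ℕ) + 1)
    (h0 : ∀ a ∈ α, ∀ j, k < j → Lm q x a j = 0) :
    qMinor (Lm q x * (Lm q x)ᵀ) α β = (Lsub q x k α hα).det * (Lsub q x k β hβ).det := by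
  rw [qMinor_eq_det _ _ _ _ hα hβ]
  have e : (Lm q x * (Lm q x)ᵀ).submatrix (α.orderEmbOfFin hα) (β.orderEmbOfFin hβ) =
      (Lm q x).submatrix (α.orderEmbOfFin hα) id *
        ((Lm q x).submatrix (β.orderEmbOfFin hβ) id)ᵀ := rfl
  rw [e, mul_trunc (Nat.succ_le_of_lt k.2), Matrix.det_mul, Matrix.det_transpose]
  · rfl
  · intro i j hj
    exact h0 _ (Finset.orderEmbOfFin_mem _ _ _) _ (by rw [Fin.lt_def]; simp only [id]; omega)

theorem exists_generic {F : Type*} [Field F] [Infinite F] {n : ℕ} (q : Fin n → QPR) :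
    ∃ x : Fin n × Fin n → F, ∀ k α β, Good q k α → Good q k β →
      qMinor (Lm q x * (Lm q x)ᵀ) α β ≠ 0 := by
  classical
  let ι := {t : Fin n × Finset (Fin n) × Finset (Fin n) // Good q t.1 t.2.1 ∧ Good q t.1 t.2.2}
  let P : ι → MvPolynomial (Fin n × Fin n) F := fun t =>
    ((Lm q (MvPolynomial.X : _ → MvPolynomial (Fin n × Fin n) F) *
      (Lm q (MvPolynomial.X : _ → MvPolynomial (Fin n × Fin n) F))ᵀ).submatrix
        (t.1.2.1.orderEmbOfFin t.2.1.1) (t.1.2.2.orderEmbOfFin t.2.2.1)).det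
  have hP : ∀ (t : ι) x, MvPolynomial.eval x (P t) =
      qMinor (Lm q x * (Lm q x)ᵀ) t.1.2.1 t.1.2.2 := by
    intro t x
    rw [qMinor_eq_det _ _ _ _ t.2.1.1 t.2.2.1]
    simp only [P]
    rw [RingHom.map_det, RingHom.mapMatrix_apply, ← Matrix.submatrix_map, Matrix.map_mul,
      Matrix.transpose_map, Lm_map]
  have hspec : ∀ t : ι, ∃ x, MvPolynomial.eval x (P t) ≠ 0 := by
    rintro ⟨⟨k, α, β⟩, ⟨hα, ha⟩, ⟨hβ, hb⟩⟩
    obtain ⟨y, hy⟩ := common_nonroot (F := F) (ι := Bool)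
      (fun b => cond b
        (Lsub q (MvPolynomial.X : Fin n × Fin n → MvPolynomial _ F) k α hα).det
        (Lsub q (MvPolynomial.X : Fin n × Fin n → MvPolynomial _ F) k β hβ).det) (by
        rintro (_ | _)
        · obtain ⟨x, hx⟩ := Lsub_spec (R := F) q k β hβ hb
          exact ⟨x, by simpa only [cond, Lsub_map] using hx⟩
        · obtain ⟨x, hx⟩ := Lsub_spec (R := F) q k α hα ha
          exact ⟨x, by simpa only [cond, Lsub_map] using hx⟩)
    have h1 := hy true
    have h2 := hy false
    simp only [cond, Lsub_map] at h1 h2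
    refine ⟨fun p => if p.2 ≤ k then y p else 0, ?_⟩
    have hz : ∀ (γ : Finset (Fin n)) (hγ : γ.card = (k : ℕ) + 1),
        Lsub q (fun p => if p.2 ≤ k then y p else 0) k γ hγ = Lsub q y k γ hγ := by
      intro γ hγ
      ext i j
      have hj : Fin.castLE (Nat.succ_le_of_lt k.2) j ≤ k := by
        rw [Fin.le_def, Fin.val_castLE]
        omega
      simp only [Lsub, Lm, Matrix.submatrix_apply, Matrix.of_apply, if_pos hj]
    rw [hP]
    dsimp only
    rw [qMinor_LL q _ k α β hα hβ, hz, hz]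
    · exact mul_ne_zero h1 h2
    · intro a _ j hj
      by_cases hh : Allowed q a j
      · rw [Lm_yes q _ hh]
        exact if_neg (not_le.2 hj)
      · exact Lm_not q _ hh
  obtain ⟨x, hx⟩ := common_nonroot P hspec
  refine ⟨x, fun k α β ha hb => ?_⟩
  have := hx ⟨⟨k, α, β⟩, ha, hb⟩
  rwa [hP] at this

theorem le_strictMono {n m : ℕ} (f : Fin m → Fin n) (hf : StrictMono f) (i : Fin m) :
    (i : ℕ) ≤ (f i : ℕ) := by
  obtain ⟨i, hi⟩ := i
  induction i with
  | zero => simp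
  | succ i ih =>
    have h1 := ih (by omega)
    have h2 : f ⟨i, by omega⟩ < f ⟨i + 1, hi⟩ := hf (by simp [Fin.lt_def])
    rw [Fin.lt_def] at h2
    simp only at h1 ⊢
    omega

theorem good_of_A {n : ℕ} (q : Fin n → QPR) (k : Fin n) (hA : q k = QPR.A)
    (hN : ∀ j ≤ k, q j ≠ QPR.N) (α : Finset (Fin n)) (h : α.card = (k : ℕ) + 1) :
    Good q k α := by
  refine ⟨h, fun i => ⟨?_, ?_, ?_⟩⟩
  · rw [Fin.le_def, Fin.val_castLE]
    exact le_strictMono _ (α.orderEmbOfFin h).strictMono i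
  · apply hN
    rw [Fin.le_def, Fin.val_castLE]
    omega
  · rintro ⟨h1, h2⟩
    by_cases hi : (i : ℕ) = k
    · have : Fin.castLE (Nat.succ_le_of_lt k.2) i = k := Fin.ext hi
      rw [this, hA] at h2
      cases h2
    · have : α.orderEmbOfFin h i < α.orderEmbOfFin h ⟨k, by omega⟩ :=
        (α.orderEmbOfFin h).strictMono (by rw [Fin.lt_def]; simp only; omega)
      rw [Fin.lt_def] at this
      omega

theorem good_Iic {n : ℕ} (q : Fin n → QPR) (k : Fin n) (hk : (k : ℕ) + 1 < n)
    (hN : ∀ j ≤ k, q j ≠ QPR.N) : Good q k (Finset.Iic k) := by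
  refine ⟨Fin.card_Iic k, fun i => ⟨?_, ?_, ?_⟩⟩
  · rw [Fin.le_def, Fin.val_castLE]
    exact le_strictMono _ (Finset.orderEmbOfFin _ _).strictMono i
  · apply hN
    rw [Fin.le_def, Fin.val_castLE]
    omega
  · rintro ⟨h1, h2⟩
    have := Finset.orderEmbOfFin_mem (Finset.Iic k) (Fin.card_Iic k) i
    rw [Finset.mem_Iic, Fin.le_def] at this
    omega

theorem zero_of_N {F : Type*} [Field F] {n : ℕ} (q : Fin n → QPR) (x : Fin n × Fin n → F)
    (k : Fin n) (hN : ∀ j, k ≤ j → q j = QPR.N) :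
    QPAllZero (Lm q x * (Lm q x)ᵀ) ((k : ℕ) + 1) := by
  rintro α β ⟨hα, hβ, -⟩
  rw [qMinor_eq_det _ _ _ _ hα hβ]
  have e : (Lm q x * (Lm q x)ᵀ).submatrix (α.orderEmbOfFin hα) (β.orderEmbOfFin hβ) =
      (Lm q x).submatrix (α.orderEmbOfFin hα) id *
        ((Lm q x).submatrix (β.orderEmbOfFin hβ) id)ᵀ := rfl
  rw [e, mul_trunc (Nat.succ_le_of_lt k.2), Matrix.det_mul]
  · rw [Matrix.det_eq_zero_of_column_eq_zero (Fin.last _), zero_mul]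
    intro i
    apply Lm_not
    rintro ⟨-, h, -⟩
    exact h (hN _ (by rw [Fin.le_def]; simp))
  · intro i j hj
    apply Lm_not
    rintro ⟨-, h, -⟩
    exact h (hN _ (by rw [Fin.le_def]; simp only [id]; omega))

theorem isQPPair_Iic {n : ℕ} (k : Fin n) :
    IsQPPair ((k : ℕ) + 1) (Finset.Iic k) (Finset.Iic k) := by
  refine ⟨Fin.card_Iic k, Fin.card_Iic k, ?_⟩
  rw [Finset.inter_self, Fin.card_Iic]
  omega

theorem attainable_of {F : Type*} [Field F] [CharZero F] {n : ℕ} (q : Fin n → QPR)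
    (h1 : ∀ k : Fin n, (k : ℕ) + 1 = n → q k ≠ QPR.S)
    (h2 : ∀ k : Fin n, ∀ hk : (k : ℕ) + 1 < n,
          q k = QPR.N → q ⟨(k : ℕ) + 1, hk⟩ = QPR.N) : Attainable F q := by
  have hprop : ∀ (d : ℕ) (j : Fin n) (hd : (j : ℕ) + d < n),
      q j = QPR.N → q ⟨(j : ℕ) + d, hd⟩ = QPR.N := by
    intro d
    induction d with
    | zero => intro j hd h; exact h
    | succ d ih =>
      intro j hd h
      exact h2 ⟨(j : ℕ) + d, by omega⟩ hd (ih j (by omega) h)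
  have hmono : ∀ i j : Fin n, i ≤ j → q i = QPR.N → q j = QPR.N := by
    intro i j hij h
    rw [Fin.le_def] at hij
    have := hprop ((j : ℕ) - i) i (by omega) h
    rwa [show (⟨(i : ℕ) + ((j : ℕ) - i), by omega⟩ : Fin n) = j from Fin.ext (by simp; omega)]
      at this
  have : Infinite F := inferInstance
  obtain ⟨x, hx⟩ := exists_generic (F := F) q
  refine ⟨Lm q x * (Lm q x)ᵀ, ?_, ?_⟩
  · rw [Matrix.IsSymm, Matrix.transpose_mul, Matrix.transpose_transpose]
  · intro k
    have hnn : q k ≠ QPR.N → ∀ j ≤ k, q j ≠ QPR.N := fun h j hj e => h (hmono j k hj e)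
    unfold qprEntry
    cases hq : q k with
    | A =>
      have hn := hnn (by rw [hq]; decide)
      rw [if_pos]
      rintro α β ⟨ha, hb, -⟩
      exact hx k α β (good_of_A q k hq hn α ha) (good_of_A q k hq hn β hb)
    | N =>
      have hz := zero_of_N q x k (fun j hj => hmono k j hj hq)
      rw [if_neg, if_pos hz]
      intro hc
      exact hc _ _ (isQPPair_Iic k) (hz _ _ (isQPPair_Iic k))
    | S =>
      have hn := hnn (by rw [hq]; decide)
      have hk : (k : ℕ) + 1 < n := by
        have : (k : ℕ) + 1 ≠ n := fun e => h1 k e hq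
        omega
      have hg := good_Iic q k hk hn
      rw [if_neg, if_neg]
      · intro hc
        exact hx k _ _ hg hg (hc _ _ (isQPPair_Iic k))
      · intro hc
        let l : Fin n := ⟨n - 1, by omega⟩
        have hl : l ∉ Finset.Iio k := by
          rw [Finset.mem_Iio, Fin.lt_def]; simp only [l]; omega
        have hcard : (insert l (Finset.Iio k)).card = (k : ℕ) + 1 := by
          rw [Finset.card_insert_of_notMem hl, Fin.card_Iio]
        apply hc (Finset.Iic k) (insert l (Finset.Iio k))
        · refine ⟨Fin.card_Iic k, hcard, ?_⟩
          have hsub : Finset.Iio k ⊆ Finset.Iic k ∩ insert l (Finset.Iio k) := by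
            intro y hy
            rw [Finset.mem_inter]
            exact ⟨Finset.mem_Iic.2 (Finset.mem_Iio.1 hy).le, Finset.mem_insert_of_mem hy⟩
          have := Finset.card_le_card hsub
          rw [Fin.card_Iio] at this
          omega
        · rw [qMinor_LL q x k _ _ (Fin.card_Iic k) hcard]
          · rw [Matrix.det_eq_zero_of_column_eq_zero (A := Lsub q x k _ hcard) (Fin.last _),
              mul_zero]
            intro i
            unfold Lsub
            rw [Matrix.submatrix_apply]
            have hlast : Fin.castLE (Nat.succ_le_of_lt k.2) (Fin.last (k : ℕ)) = k :=
              Fin.ext rfl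
            rw [hlast]
            apply Lm_not
            rintro ⟨hle, -, hnot⟩
            have hm := Finset.orderEmbOfFin_mem _ hcard i
            rw [Finset.mem_insert, Finset.mem_Iio] at hm
            rcases hm with hm | hm
            · rw [hm] at hnot
              exact hnot ⟨by simp only [l]; omega, hq⟩
            · exact absurd hle (not_le.2 hm)
          · intro a ha j hj
            apply Lm_not
            rintro ⟨hle, -, -⟩
            exact absurd (hle.trans (Finset.mem_Iic.1 ha)) (not_le.2 hj)

theorem allZero_of_entry {R : Type*} [CommRing R] {m : Type*} [Fintype m] [LinearOrder m]
    (B : Matrix m m R) (k : ℕ) (h : qprEntry B k = QPR.N) : QPAllZero B k := by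
  unfold qprEntry at h
  split_ifs at h with h1 h2
  exact h2

/-- a sequence from `{A, S, N}` is attainable over a field of characteristic 0
iff (i) the last term is not `S`, and (ii) every term immediately following an `N` is `N`
(i.e. neither `NA` nor `NS` occurs as a consecutive subsequence). -/
theorem stmt_1 {F : Type*} [Field F] [CharZero F] {n : ℕ} (q : Fin n → QPR) :
    Attainable F q ↔
      ((∀ hn : 0 < n, q ⟨n - 1, by omega⟩ ≠ QPR.S) ∧
        ∀ k : Fin n, ∀ hk : (k : ℕ) + 1 < n,
          q k = QPR.N → q ⟨(k : ℕ) + 1, hk⟩ = QPR.N) := by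
  constructor
  · rintro ⟨B, -, hB⟩
    constructor
    · intro hn hS
      have h := hB ⟨n - 1, by omega⟩
      rw [hS] at h
      have hu : ∀ α : Finset (Fin n), α.card = n - 1 + 1 → α = Finset.univ := by
        intro α ha
        rw [← Finset.card_eq_iff_eq_univ, Fintype.card_fin]
        omega
      unfold qprEntry at h
      split_ifs at h with h1 h2
      apply h1
      rintro α β ⟨ha, hb, -⟩ h0
      apply h2
      rintro α' β' ⟨ha', hb', -⟩
      rw [hu α ha, hu β hb] at h0
      rw [hu α' ha', hu β' hb', h0]
    · intro k hk hN
      have h0 := allZero_of_entry B _ ((hB k).trans hN)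
      have h1 := allZero_succ B _ h0
      rw [← hB ⟨(k : ℕ) + 1, hk⟩]
      unfold qprEntry
      rw [if_neg, if_pos]
      · exact h1
      · intro hc
        exact hc _ _ (isQPPair_Iic ⟨(k : ℕ) + 1, hk⟩) (h1 _ _ (isQPPair_Iic ⟨(k : ℕ) + 1, hk⟩))
  · rintro ⟨h1, h2⟩
    refine attainable_of q ?_ h2
    intro k hk
    have := h1 (by omega)
    rwa [show (⟨n - 1, by omega⟩ : Fin n) = k from Fin.ext (by simp only; omega)] at this
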